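/- Let α ∈ ℝ and M = ℝ² ∖ {(0,0)}. Consider the smooth SDE (μ,σ) on M (with m = 2) given by μ(x,z) = (αx/(x²+z²), −αz/(x²+z²))^T and σ(x,z) = [[(x²−z²)/√(x²+z²), 0], [0, (x²−z²)/√(x²+z²)]]. Then V = (Y, C, 0) with Y(x,z) = (z/(x²+z²), x/(x²+z²))^T and C(x,z) = [[0, (x²−z²)/(x²+z²)²], [−(x²−z²)/(x²+z²)², 0]] is an infinitesimal symmetry of (μ,σ). -/

import Mathlib

noncomputable section

open scoped BigOperators

/-- Partial derivative `∂_j f` at `x`. -/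
def pd {d : ℕ} (f : (Fin d → ℝ) → ℝ) (j : Fin d) (x : Fin d → ℝ) : ℝ :=
  fderiv ℝ f x (Pi.single j 1)

/-- A vector field `Y` applied to a scalar function: `Y(f) = ∑ k Y^k ∂_k f`. -/
def vfApp {d : ℕ} (Y : (Fin d → ℝ) → Fin d → ℝ) (f : (Fin d → ℝ) → ℝ)
    (x : Fin d → ℝ) : ℝ :=
  ∑ k, Y x k * pd f k x

/-- Lie bracket of two vector fields. -/
def vfBracket {d : ℕ} (X Y : (Fin d → ℝ) → Fin d → ℝ) (x : Fin d → ℝ) :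
    Fin d → ℝ :=
  fun i => ∑ k, (X x k * pd (fun y => Y y i) k x - Y x k * pd (fun y => X y i) k x)

/-- The bracket `[H,K]` of a vector field `H` with a matrix-valued map `K`. -/
def mixBracket {d m : ℕ} (H : (Fin d → ℝ) → Fin d → ℝ)
    (K : (Fin d → ℝ) → Fin d → Fin m → ℝ) (x : Fin d → ℝ) : Fin d → Fin m → ℝ :=
  fun i j => ∑ k, (H x k * pd (fun y => K y i j) k x - K x k j * pd (fun y => H y i) k x)

/-- The generator `L` of the SDE `(μ,σ)`. -/
def gen {d m : ℕ} (μ : (Fin d → ℝ) → Fin d → ℝ)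
    (σ : (Fin d → ℝ) → Fin d → Fin m → ℝ)
    (f : (Fin d → ℝ) → ℝ) (x : Fin d → ℝ) : ℝ :=
  (1/2) * ∑ α : Fin m, ∑ i, ∑ j, σ x i α * σ x j α * pd (fun y => pd f j y) i x
    + ∑ i, μ x i * pd f i x

/-- The determining equations: `(Y,C,τ)` is an infinitesimal symmetry of `(μ,σ)` on `M`. -/
def IsSymmetry {d m : ℕ} (M : Set (Fin d → ℝ))
    (μ : (Fin d → ℝ) → Fin d → ℝ) (σ : (Fin d → ℝ) → Fin d → Fin m → ℝ)
    (Y : (Fin d → ℝ) → Fin d → ℝ) (C : (Fin d → ℝ) → Fin m → Fin m → ℝ)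
    (τ : (Fin d → ℝ) → ℝ) : Prop :=
  (∀ x ∈ M, ∀ i α, mixBracket Y σ x i α
      = -(1/2) * τ x * σ x i α - ∑ β, σ x i β * C x β α) ∧
  (∀ x ∈ M, ∀ i,
      vfApp Y (fun y => μ y i) x - gen μ σ (fun y => Y y i) x = - τ x * μ x i)

theorem pd_proj {d : ℕ} (i j : Fin d) (x : Fin d → ℝ) :
    pd (fun p => p i) j x = (Pi.single j 1 : Fin d → ℝ) i := by
  unfold pd
  rw [(hasFDerivAt_apply i x).fderiv]
  rfl

theorem pd_const {d : ℕ} (c : ℝ) (j : Fin d) (x : Fin d → ℝ) :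
    pd (fun _ => c) j x = 0 := by
  simp [pd]

theorem pd_add {d : ℕ} {f g : (Fin d → ℝ) → ℝ} {x : Fin d → ℝ} (j : Fin d)
    (hf : DifferentiableAt ℝ f x) (hg : DifferentiableAt ℝ g x) :
    pd (fun p => f p + g p) j x = pd f j x + pd g j x := by
  unfold pd
  rw [fderiv_fun_add hf hg]
  rfl

theorem pd_sub {d : ℕ} {f g : (Fin d → ℝ) → ℝ} {x : Fin d → ℝ} (j : Fin d)
    (hf : DifferentiableAt ℝ f x) (hg : DifferentiableAt ℝ g x) :
    pd (fun p => f p - g p) j x = pd f j x - pd g j x := by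
  unfold pd
  rw [fderiv_fun_sub hf hg]
  rfl

theorem pd_neg {d : ℕ} (f : (Fin d → ℝ) → ℝ) (j : Fin d) (x : Fin d → ℝ) :
    pd (fun p => -f p) j x = -pd f j x := by
  unfold pd
  rw [fderiv_fun_neg]
  rfl

theorem pd_mul {d : ℕ} {f g : (Fin d → ℝ) → ℝ} {x : Fin d → ℝ} (j : Fin d)
    (hf : DifferentiableAt ℝ f x) (hg : DifferentiableAt ℝ g x) :
    pd (fun p => f p * g p) j x = f x * pd g j x + g x * pd f j x := by
  unfold pd
  rw [fderiv_fun_mul hf hg]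
  rfl

theorem pd_pow {d : ℕ} {f : (Fin d → ℝ) → ℝ} {x : Fin d → ℝ} (n : ℕ) (j : Fin d)
    (hf : DifferentiableAt ℝ f x) :
    pd (fun p => f p ^ n) j x = n * f x ^ (n - 1) * pd f j x := by
  unfold pd
  rw [(hf.hasFDerivAt.pow n).fderiv]
  simp

theorem pd_div {d : ℕ} {f g : (Fin d → ℝ) → ℝ} {x : Fin d → ℝ} (j : Fin d)
    (hf : DifferentiableAt ℝ f x) (hg : DifferentiableAt ℝ g x) (h0 : g x ≠ 0) :
    pd (fun p => f p / g p) j x = (pd f j x * g x - f x * pd g j x) / g x ^ 2 := by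
  have hinv : HasFDerivAt (fun p => (g p)⁻¹) (-(g x ^ 2)⁻¹ • fderiv ℝ g x) x :=
    (hasDerivAt_inv h0).comp_hasFDerivAt x hg.hasFDerivAt
  simp only [div_eq_mul_inv]
  rw [pd_mul j hf hinv.differentiableAt]
  unfold pd
  rw [hinv.fderiv]
  simp only [smul_apply, smul_eq_mul]
  field_simp
  ring

theorem pd_sqrt {d : ℕ} {f : (Fin d → ℝ) → ℝ} {x : Fin d → ℝ} (j : Fin d)
    (hf : DifferentiableAt ℝ f x) (h0 : f x ≠ 0) :
    pd (fun p => Real.sqrt (f p)) j x = pd f j x / (2 * Real.sqrt (f x)) := by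
  unfold pd
  rw [(hf.hasFDerivAt.sqrt h0).fderiv]
  simp
  ring

theorem pd_congr {d : ℕ} {f g : (Fin d → ℝ) → ℝ} {x : Fin d → ℝ} (j : Fin d)
    (h : f =ᶠ[nhds x] g) : pd f j x = pd g j x := by
  unfold pd
  rw [h.fderiv_eq]

theorem sq_add_sq_pos_of_ne_zero {p : Fin 2 → ℝ} (hp : p ≠ 0) :
    0 < (p 0) ^ 2 + (p 1) ^ 2 := by
  by_contra! h
  have h0 : p 0 = 0 := by nlinarith [sq_nonneg (p 0), sq_nonneg (p 1)]
  have h1 : p 1 = 0 := by nlinarith [sq_nonneg (p 0), sq_nonneg (p 1)]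
  apply hp
  ext i
  fin_cases i <;> simp [h0, h1]

theorem pd_sq_add_sq (j : Fin 2) (x : Fin 2 → ℝ) :
    pd (fun p : Fin 2 → ℝ => (p 0) ^ 2 + (p 1) ^ 2) j x = 2 * x j := by
  rw [pd_add j (by fun_prop) (by fun_prop), pd_pow 2 j (by fun_prop),
    pd_pow 2 j (by fun_prop), pd_proj, pd_proj]
  fin_cases j <;> simp

/-- Partial derivatives of a coordinate divided by the squared radius. -/
theorem pd_proj_div (i j : Fin 2) {x : Fin 2 → ℝ} (hx : x ≠ 0) :
    pd (fun p : Fin 2 → ℝ => p i / ((p 0) ^ 2 + (p 1) ^ 2)) j x =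
      ((Pi.single j 1 : Fin 2 → ℝ) i * ((x 0) ^ 2 + (x 1) ^ 2) - x i * (2 * x j)) /
        ((x 0) ^ 2 + (x 1) ^ 2) ^ 2 := by
  rw [pd_div j (by fun_prop) (by fun_prop) (sq_add_sq_pos_of_ne_zero hx).ne', pd_proj,
    pd_sq_add_sq]

/-- Second partial derivatives of a coordinate divided by the squared radius. -/
theorem pd_pd_proj_div (i j k : Fin 2) {x : Fin 2 → ℝ} (hx : x ≠ 0) :
    pd (fun y => pd (fun p : Fin 2 → ℝ => p i / ((p 0) ^ 2 + (p 1) ^ 2)) j y) k x =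
      (((Pi.single j 1 : Fin 2 → ℝ) i * (2 * x k) -
          (x i * (2 * (Pi.single k 1 : Fin 2 → ℝ) j) +
            2 * x j * (Pi.single k 1 : Fin 2 → ℝ) i)) * ((x 0) ^ 2 + (x 1) ^ 2) ^ 2 -
        ((Pi.single j 1 : Fin 2 → ℝ) i * ((x 0) ^ 2 + (x 1) ^ 2) - x i * (2 * x j)) *
          (2 * ((x 0) ^ 2 + (x 1) ^ 2) * (2 * x k))) /
        (((x 0) ^ 2 + (x 1) ^ 2) ^ 2) ^ 2 := by
  have h := sq_add_sq_pos_of_ne_zero hx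
  rw [pd_congr k ((eventually_ne_nhds hx).mono fun y hy => pd_proj_div i j hy),
    pd_div k (by fun_prop) (by fun_prop) (by positivity), pd_sub k (by fun_prop) (by fun_prop),
    pd_mul k (by fun_prop) (by fun_prop), pd_mul k (by fun_prop) (by fun_prop),
    pd_mul k (by fun_prop) (by fun_prop), pd_pow 2 k (by fun_prop), pd_sq_add_sq,
    pd_const, pd_const, pd_proj, pd_proj]
  simp

theorem pd_const_mul_proj_div (a : ℝ) (i j : Fin 2) {x : Fin 2 → ℝ} (hx : x ≠ 0) :
    pd (fun p : Fin 2 → ℝ => a * p i / ((p 0) ^ 2 + (p 1) ^ 2)) j x =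
      a * (((Pi.single j 1 : Fin 2 → ℝ) i * ((x 0) ^ 2 + (x 1) ^ 2) - x i * (2 * x j)) /
        ((x 0) ^ 2 + (x 1) ^ 2) ^ 2) := by
  have h := (sq_add_sq_pos_of_ne_zero hx).ne'
  simp only [mul_div_assoc]
  rw [pd_mul j (by fun_prop) (by fun_prop (disch := exact h)), pd_const, pd_proj_div i j hx]
  ring

/-- Partial derivatives of the diffusion coefficient. -/
theorem pd_sq_sub_sq_div_sqrt (j : Fin 2) {x : Fin 2 → ℝ} (hx : x ≠ 0) :
    pd (fun p : Fin 2 → ℝ =>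
        ((p 0) ^ 2 - (p 1) ^ 2) / Real.sqrt ((p 0) ^ 2 + (p 1) ^ 2)) j x =
      ((2 * x 0 * (Pi.single j 1 : Fin 2 → ℝ) 0 - 2 * x 1 * (Pi.single j 1 : Fin 2 → ℝ) 1) *
          ((x 0) ^ 2 + (x 1) ^ 2) - ((x 0) ^ 2 - (x 1) ^ 2) * x j) /
        (((x 0) ^ 2 + (x 1) ^ 2) * Real.sqrt ((x 0) ^ 2 + (x 1) ^ 2)) := by
  have h := sq_add_sq_pos_of_ne_zero hx
  have hs := Real.sqrt_pos.2 h
  rw [pd_div j (by fun_prop) (by fun_prop (disch := exact h.ne')) hs.ne',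
    pd_sub j (by fun_prop) (by fun_prop), pd_pow 2 j (by fun_prop), pd_pow 2 j (by fun_prop),
    pd_sqrt j (by fun_prop) h.ne', pd_sq_add_sq, pd_proj, pd_proj, Real.sq_sqrt h.le]
  have hsq := Real.sq_sqrt h.le
  set r := Real.sqrt ((x 0) ^ 2 + (x 1) ^ 2)
  rw [← hsq]
  field_simp
  norm_num
  ring

/-- Subsection 5.2.  For the singular SDE on `ℝ² ∖ {0}`, the triple
`V = (Y,C,0)` is an infinitesimal symmetry. -/
theorem singular_SDE_symmetry (α : ℝ) :
    IsSymmetry (m := 2) {p : Fin 2 → ℝ | p ≠ 0}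
      (fun p => ![α * p 0 / ((p 0) ^ 2 + (p 1) ^ 2),
        -(α * p 1) / ((p 0) ^ 2 + (p 1) ^ 2)])
      (fun p => ![![((p 0) ^ 2 - (p 1) ^ 2) / Real.sqrt ((p 0) ^ 2 + (p 1) ^ 2), 0],
        ![0, ((p 0) ^ 2 - (p 1) ^ 2) / Real.sqrt ((p 0) ^ 2 + (p 1) ^ 2)]])
      (fun p => ![p 1 / ((p 0) ^ 2 + (p 1) ^ 2), p 0 / ((p 0) ^ 2 + (p 1) ^ 2)])
      (fun p => ![![0, ((p 0) ^ 2 - (p 1) ^ 2) / ((p 0) ^ 2 + (p 1) ^ 2) ^ 2],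
        ![-(((p 0) ^ 2 - (p 1) ^ 2) / ((p 0) ^ 2 + (p 1) ^ 2) ^ 2), 0]])
      (fun _ => 0) := by
  constructor
  · intro x hx i β
    have hx : x ≠ 0 := hx
    have h := sq_add_sq_pos_of_ne_zero hx
    have hs := Real.sqrt_pos.2 h
    fin_cases i <;> fin_cases β <;>
      simp [-mul_eq_mul_left_iff, -mul_eq_mul_right_iff, mixBracket, Fin.sum_univ_two, pd_const, pd_proj_div _ _ hx,
        pd_sq_sub_sq_div_sqrt _ hx] <;>
      field_simp <;> ring
  · intro x hx i
    have hx : x ≠ 0 := hx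
    have h := sq_add_sq_pos_of_ne_zero hx
    fin_cases i <;>
      simp [vfApp, gen, Fin.sum_univ_two, pd_proj_div _ _ hx, pd_pd_proj_div _ _ _ hx,
        neg_div, pd_neg, pd_const_mul_proj_div _ _ _ hx] <;>
      field_simp <;> ring_nf
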